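/- Let π be a probability density on ℝ^d such that −log π is twice differentiable and m-strongly convex for some m > 0. Let ρ > 0, L ≥ 0, and let ℓ₁,…,ℓₙ and ℓ'₁,…,ℓ'ₙ : ℝ^d → ℝ be convex, L-Lipschitz functions with ℓᵢ = ℓ'ᵢ for all indices except one. Let P and P' be the probability measures on ℝ^d with Lebesgue densities proportional to exp(−ρ·Σᵢ ℓᵢ(w))·π(w) and exp(−ρ·Σᵢ ℓ'ᵢ(w))·π(w), respectively. Then the Kullback–Leibler divergence satisfies KL(P ‖ P') ≤ 2ρ²L²/m. -/

import Mathlib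

/-!
STATEMENT 14: Let `π` be a probability density on `ℝ^d` with `−log π` twice
differentiable and `m`-strongly convex, `ρ > 0`, `L ≥ 0`, and let
`ℓ₁,…,ℓₙ`, `ℓ'₁,…,ℓ'ₙ` be convex `L`-Lipschitz functions differing at only one index.
If `P`, `P'` have densities proportional to `exp(−ρΣᵢℓᵢ)·π` and `exp(−ρΣᵢℓ'ᵢ)·π`, then
`KL(P ‖ P') ≤ 2ρ²L²/m`.
-/

open MeasureTheory ENNReal

variable {d n : ℕ}

/-- Unnormalized Gibbs posterior density `exp(−ρ·Σᵢ ℓᵢ(w))·π(w)`. -/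
noncomputable def gibbsUnnorm (π : EuclideanSpace ℝ (Fin d) → ℝ) (ρ : ℝ)
    (ℓ : Fin n → EuclideanSpace ℝ (Fin d) → ℝ) (w : EuclideanSpace ℝ (Fin d)) : ℝ :=
  Real.exp (-(ρ * ∑ i, ℓ i w)) * π w

/-- Normalized Gibbs posterior density (w.r.t. Lebesgue measure on `ℝ^d`). -/
noncomputable def gibbsDens (π : EuclideanSpace ℝ (Fin d) → ℝ) (ρ : ℝ)
    (ℓ : Fin n → EuclideanSpace ℝ (Fin d) → ℝ) (w : EuclideanSpace ℝ (Fin d)) : ℝ≥0∞ :=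
  ENNReal.ofReal (gibbsUnnorm π ρ ℓ w) / ∫⁻ w', ENNReal.ofReal (gibbsUnnorm π ρ ℓ w')

/-- Rényi divergence of order `l > 1` between measures given by densities `p`, `q`
with respect to a common dominating measure `ν`, with value `+∞` if the integral
diverges. -/
noncomputable def renyiDiv {Ω : Type*} [MeasurableSpace Ω] (ν : Measure Ω)
    (p q : Ω → ℝ≥0∞) (l : ℝ) : EReal :=
  (((l - 1)⁻¹ : ℝ) : EReal) * ENNReal.log (∫⁻ ω, p ω ^ l * q ω ^ (1 - l) ∂ν)

/-- Kullback–Leibler divergence `KL(P‖Q) = ∫ log(dP/dQ) dP` if `P ≪ Q` (and the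
integrand is integrable), `+∞` otherwise. -/
noncomputable def klDiv' {Ω : Type*} [MeasurableSpace Ω] (P Q : Measure Ω) : EReal :=
  @ite _ (P ≪ Q ∧ Integrable (llr P Q) P) (Classical.propDecidable _)
    ((∫ ω, llr P Q ω ∂P : ℝ) : EReal) ⊤

open Pointwise in
theorem Real.volume_add_volume_le_volume_add_of_isCompact {K K' : Set ℝ} (hK : IsCompact K)
    (hK' : IsCompact K') (hne : K.Nonempty) (hne' : K'.Nonempty) :
    volume K + volume K' ≤ volume (K + K') := by
  set a := sSup K
  set b := sInf K'
  have ha : a ∈ K := hK.sSup_mem hne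
  have hb : b ∈ K' := hK'.sInf_mem hne'
  have hsub : (b +ᵥ K) ∪ (a +ᵥ K') ⊆ K + K' := by
    rintro x (⟨y, hy, rfl⟩ | ⟨y, hy, rfl⟩)
    · exact ⟨y, hy, b, hb, by simp [add_comm]⟩
    · exact ⟨a, ha, y, hy, by simp⟩
  have hinter : (b +ᵥ K) ∩ (a +ᵥ K') ⊆ {a + b} := by
    rintro x ⟨⟨y, hy, rfl⟩, ⟨z, hz, hxz⟩⟩
    have h1 : y ≤ a := le_csSup hK.bddAbove hy
    have h2 : b ≤ z := csInf_le hK'.bddBelow hz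
    simp only [vadd_eq_add, Set.mem_singleton_iff] at hxz ⊢
    linarith
  have hdisj : AEDisjoint volume (b +ᵥ K) (a +ᵥ K') :=
    measure_mono_null hinter (by simp)
  calc volume K + volume K' = volume (b +ᵥ K) + volume (a +ᵥ K') := by
        rw [measure_vadd, measure_vadd]
    _ = volume ((b +ᵥ K) ∪ (a +ᵥ K')) :=
        (measure_union₀ (hK'.vadd a).measurableSet.nullMeasurableSet hdisj).symm
    _ ≤ _ := measure_mono hsub

open Pointwise in
/-- One-dimensional Brunn–Minkowski inequality. -/
theorem Real.volume_add_volume_le_volume_add {A B : Set ℝ} (hA : MeasurableSet A)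
    (hB : MeasurableSet B) (hne : A.Nonempty) (hne' : B.Nonempty) :
    volume A + volume B ≤ volume (A + B) := by
  obtain ⟨a, ha⟩ := hne
  obtain ⟨b, hb⟩ := hne'
  rw [hA.measure_eq_iSup_isCompact, hB.measure_eq_iSup_isCompact]
  simp_rw [iSup_and']
  refine ENNReal.biSup_add_biSup_le' ⟨∅, by simp⟩ ⟨∅, by simp⟩ fun K hK K' hK' => ?_
  calc volume K + volume K' ≤ volume (insert a K) + volume (insert b K') := by
        gcongr <;> exact Set.subset_insert _ _
    _ ≤ volume (insert a K + insert b K') :=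
        volume_add_volume_le_volume_add_of_isCompact (hK.2.insert a) (hK'.2.insert b)
          (Set.insert_nonempty _ _) (Set.insert_nonempty _ _)
    _ ≤ _ := measure_mono (Set.add_subset_add (Set.insert_subset ha hK.1)
          (Set.insert_subset hb hK'.1))

open Pointwise in
theorem Real.volume_convexComb_le {t s : ℝ} (ht : 0 < t) (hs : 0 < s) {A B C : Set ℝ}
    (hA : MeasurableSet A) (hB : MeasurableSet B) (hne : A.Nonempty) (hne' : B.Nonempty)
    (hC : ∀ x ∈ A, ∀ y ∈ B, t * x + s * y ∈ C) :
    ENNReal.ofReal t * volume A + ENNReal.ofReal s * volume B ≤ volume C := by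
  have h := volume_add_volume_le_volume_add (hA.const_smul₀ t) (hB.const_smul₀ s)
    (hne.smul_set (a := t)) (hne'.smul_set (a := s))
  simp only [Measure.addHaar_smul, Module.finrank_self, pow_one, abs_of_pos ht,
    abs_of_pos hs] at h
  refine h.trans (measure_mono ?_)
  rintro _ ⟨_, ⟨x, hx, rfl⟩, _, ⟨y, hy, rfl⟩, rfl⟩
  exact hC x hx y hy

/-- The Prékopa–Leindler inequality on the line, for functions with supremum one. -/
theorem lintegral_prekopaLeindler_of_sup_eq_one {t s : ℝ} (ht : 0 < t) (hs : 0 < s)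
    (hts : t + s = 1) {f g k : ℝ → ℝ} (hf : Measurable f) (hg : Measurable g)
    (hk : Measurable k) (hf0 : ∀ x, 0 ≤ f x) (hg0 : ∀ x, 0 ≤ g x) (hk0 : ∀ x, 0 ≤ k x)
    (hf1 : ∀ x, f x ≤ 1) (hg1 : ∀ x, g x ≤ 1)
    (hfs : ∀ r < 1, ∃ x, r < f x) (hgs : ∀ r < 1, ∃ x, r < g x)
    (h : ∀ x y, f x ^ t * g y ^ s ≤ k (t * x + s * y)) :
    ENNReal.ofReal t * (∫⁻ x, ENNReal.ofReal (f x)) +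
      ENNReal.ofReal s * (∫⁻ x, ENNReal.ofReal (g x)) ≤ ∫⁻ x, ENNReal.ofReal (k x) := by
  rw [lintegral_eq_lintegral_meas_lt _ (.of_forall hf0) hf.aemeasurable,
    lintegral_eq_lintegral_meas_lt _ (.of_forall hg0) hg.aemeasurable,
    lintegral_eq_lintegral_meas_lt _ (.of_forall hk0) hk.aemeasurable]
  have hmeas : ∀ q : ℝ → ℝ, Measurable fun r => volume {x | r < q x} := fun q =>
    Antitone.measurable fun r r' hr => measure_mono fun x hx => lt_of_le_of_lt hr hx
  rw [← lintegral_const_mul _ (hmeas f), ← lintegral_const_mul _ (hmeas g),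
    ← lintegral_add_left ((hmeas f).const_mul _)]
  refine setLIntegral_mono (hmeas k) fun r hr => ?_
  have hr0 : 0 < r := hr
  by_cases hr1 : r < 1
  · refine Real.volume_convexComb_le ht hs (measurableSet_lt measurable_const hf)
      (measurableSet_lt measurable_const hg) (hfs r hr1) (hgs r hr1) fun x hx y hy => ?_
    refine lt_of_lt_of_le ?_ (h x y)
    calc r = r ^ t * r ^ s := by rw [← Real.rpow_add hr0, hts, Real.rpow_one]
      _ < f x ^ t * g y ^ s := by
        have hx' : r < f x := hx
        have hy' : r < g y := hy
        gcongr
  · have e : ∀ q : ℝ → ℝ, (∀ x, q x ≤ 1) → {x | r < q x} = ∅ := fun q hq => by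
      ext x; simpa using (hq x).trans (not_lt.1 hr1)
    simp [e f hf1, e g hg1]

theorem ENNReal.geom_mean_le_arith_mean2_weighted' {t s : ℝ} (ht : 0 < t) (hs : 0 < s)
    (hts : t + s = 1) (x y : ℝ≥0∞) :
    x ^ t * y ^ s ≤ ENNReal.ofReal t * x + ENNReal.ofReal s * y := by
  have hpq : (t⁻¹).HolderConjugate s⁻¹ :=
    Real.holderConjugate_iff.2 ⟨(one_lt_inv₀ ht).2 (by linarith), by simpa using hts⟩
  have h := ENNReal.young_inequality (x ^ t) (y ^ s) hpq
  rw [← ENNReal.rpow_mul, ← ENNReal.rpow_mul, mul_inv_cancel₀ ht.ne', mul_inv_cancel₀ hs.ne',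
    ENNReal.rpow_one, ENNReal.rpow_one, ENNReal.ofReal_inv_of_pos ht,
    ENNReal.ofReal_inv_of_pos hs, ENNReal.div_eq_inv_mul, ENNReal.div_eq_inv_mul, inv_inv,
    inv_inv] at h
  exact h

/-- The Prékopa–Leindler inequality holds on the measure space `E`. -/
def PrekopaLeindler (E : Type*) [AddCommGroup E] [Module ℝ E] [MeasureSpace E] : Prop :=
  ∀ ⦃t s : ℝ⦄, 0 < t → 0 < s → t + s = 1 → ∀ ⦃u v h : E → ℝ≥0∞⦄,
    Measurable u → Measurable v → Measurable h →
    (∀ x y, u x ^ t * v y ^ s ≤ h (t • x + s • y)) →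
    (∫⁻ x, u x) ^ t * (∫⁻ x, v x) ^ s ≤ ∫⁻ x, h x

theorem lintegral_prekopaLeindler_of_bounded {t s : ℝ} (ht : 0 < t) (hs : 0 < s)
    (hts : t + s = 1) {u v h : ℝ → ℝ≥0∞} (hu : Measurable u) (hv : Measurable v)
    (hh : Measurable h) {N : ℝ≥0∞} (hN : N ≠ ∞) (huN : ∀ x, u x ≤ N) (hvN : ∀ x, v x ≤ N)
    (huv : ∀ x y, u x ^ t * v y ^ s ≤ h (t * x + s * y)) :
    (∫⁻ x, u x) ^ t * (∫⁻ x, v x) ^ s ≤ ∫⁻ x, h x := by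
  set a := ⨆ x, u x with ha
  set b := ⨆ x, v x with hb
  have hat : a ≠ ∞ := ne_top_of_le_ne_top hN (iSup_le huN)
  have hbt : b ≠ ∞ := ne_top_of_le_ne_top hN (iSup_le hvN)
  rcases eq_or_ne a 0 with ha0 | ha0
  · have : ∀ x, u x = 0 := by simpa using ENNReal.iSup_eq_zero.1 ha0
    simp [this, ht]
  rcases eq_or_ne b 0 with hb0 | hb0
  · have : ∀ x, v x = 0 := by simpa using ENNReal.iSup_eq_zero.1 hb0
    simp [this, hs]
  set c := a ^ t * b ^ s with hc
  have hat0 : a ^ t ≠ 0 := by simp [ha0, hat]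
  have hbs0 : b ^ s ≠ 0 := by simp [hb0, hbt]
  have hatt : a ^ t ≠ ∞ := ENNReal.rpow_ne_top_of_nonneg ht.le hat
  have hbst : b ^ s ≠ ∞ := ENNReal.rpow_ne_top_of_nonneg hs.le hbt
  have hc0 : c ≠ 0 := mul_ne_zero hat0 hbs0
  have hct : c ≠ ∞ := ENNReal.mul_ne_top hatt hbst
  have hu1 : ∀ x, u x / a ≤ 1 := fun x => ENNReal.div_le_of_le_mul (by simpa using le_iSup u x)
  have hv1 : ∀ x, v x / b ≤ 1 := fun x => ENNReal.div_le_of_le_mul (by simpa using le_iSup v x)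
  have hut : ∀ x, u x / a ≠ ∞ := fun x => ne_top_of_le_ne_top one_ne_top (hu1 x)
  have hvt : ∀ x, v x / b ≠ ∞ := fun x => ne_top_of_le_ne_top one_ne_top (hv1 x)
  have hkt : ∀ x, min (h x / c) 1 ≠ ∞ := fun x =>
    ne_top_of_le_ne_top one_ne_top (min_le_right _ _)
  have hsup : ∀ {q : ℝ → ℝ≥0∞}, (∀ x, q x / (⨆ y, q y) ≠ ∞) → (⨆ y, q y) ≠ 0 →
      (⨆ y, q y) ≠ ∞ → ∀ r < (1 : ℝ), ∃ x, r < (q x / (⨆ y, q y)).toReal := by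
    intro q hq h0 htop r hr
    have h1 : ENNReal.ofReal r * (⨆ y, q y) < ⨆ y, q y := by
      calc ENNReal.ofReal r * (⨆ y, q y) < 1 * (⨆ y, q y) :=
            ENNReal.mul_lt_mul_left h0 htop (by simpa using hr)
        _ = _ := one_mul _
    obtain ⟨x, hx⟩ := lt_iSup_iff.1 h1
    have h2 := (ENNReal.lt_div_iff_mul_lt (.inl h0) (.inl htop)).2 hx
    exact ⟨x, lt_of_not_ge fun hle => h2.not_ge
      ((ENNReal.ofReal_toReal (hq x)).symm.le.trans (ENNReal.ofReal_le_ofReal hle))⟩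
  have key := lintegral_prekopaLeindler_of_sup_eq_one ht hs hts
    (f := fun x => (u x / a).toReal) (g := fun x => (v x / b).toReal)
    (k := fun x => (min (h x / c) 1).toReal)
    (hu.div_const a).ennreal_toReal (hv.div_const b).ennreal_toReal
    ((hh.div_const c).min measurable_const).ennreal_toReal
    (fun _ => ENNReal.toReal_nonneg) (fun _ => ENNReal.toReal_nonneg)
    (fun _ => ENNReal.toReal_nonneg)
    (fun x => by simpa using ENNReal.toReal_mono one_ne_top (hu1 x))
    (fun x => by simpa using ENNReal.toReal_mono one_ne_top (hv1 x))
    (hsup hut ha0 hat) (hsup hvt hb0 hbt) (fun x y => by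
      rw [ENNReal.toReal_rpow, ENNReal.toReal_rpow, ← ENNReal.toReal_mul]
      refine ENNReal.toReal_mono (hkt _) (le_min ?_ ?_)
      · rw [ENNReal.div_rpow_of_nonneg _ _ ht.le, ENNReal.div_rpow_of_nonneg _ _ hs.le]
        refine (ENNReal.le_div_iff_mul_le (.inl hc0) (.inl hct)).2 ?_
        calc u x ^ t / a ^ t * (v y ^ s / b ^ s) * (a ^ t * b ^ s)
            = (u x ^ t / a ^ t * a ^ t) * (v y ^ s / b ^ s * b ^ s) := by ring
          _ = u x ^ t * v y ^ s := by
            rw [ENNReal.div_mul_cancel hat0 hatt, ENNReal.div_mul_cancel hbs0 hbst]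
          _ ≤ _ := huv x y
      · exact mul_le_one' (ENNReal.rpow_le_one (hu1 x) ht.le) (ENNReal.rpow_le_one (hv1 y) hs.le))
  simp only [ENNReal.ofReal_toReal (hut _), ENNReal.ofReal_toReal (hvt _),
    ENNReal.ofReal_toReal (hkt _)] at key
  have hmin : ∫⁻ x, min (h x / c) 1 ≤ ∫⁻ x, h x / c := lintegral_mono fun x => min_le_left _ _
  have key2 := (ENNReal.geom_mean_le_arith_mean2_weighted' ht hs hts _ _).trans (key.trans hmin)
  simp only [div_eq_mul_inv] at key2
  rw [lintegral_mul_const _ hu, lintegral_mul_const _ hv, lintegral_mul_const _ hh] at key2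
  simp only [← div_eq_mul_inv] at key2
  rw [ENNReal.div_rpow_of_nonneg _ _ ht.le, ENNReal.div_rpow_of_nonneg _ _ hs.le,
    ENNReal.le_div_iff_mul_le (.inl hc0) (.inl hct)] at key2
  calc (∫⁻ x, u x) ^ t * (∫⁻ x, v x) ^ s
      = ((∫⁻ x, u x) ^ t / a ^ t * a ^ t) * ((∫⁻ x, v x) ^ s / b ^ s * b ^ s) := by
        rw [ENNReal.div_mul_cancel hat0 hatt, ENNReal.div_mul_cancel hbs0 hbst]
    _ = (∫⁻ x, u x) ^ t / a ^ t * ((∫⁻ x, v x) ^ s / b ^ s) * (a ^ t * b ^ s) := by ring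
    _ ≤ _ := key2

theorem ENNReal.iSup_min_natCast (x : ℝ≥0∞) : ⨆ N : ℕ, min x N = x := by
  rw [← inf_iSup_eq, ENNReal.iSup_natCast, inf_top_eq]

theorem prekopaLeindler_real : PrekopaLeindler ℝ := by
  intro t s ht hs hts u v h hu hv hh huv
  have hmono : ∀ q : ℝ → ℝ≥0∞, Monotone fun (N : ℕ) x => min (q x) (N : ℝ≥0∞) :=
    fun q N M hNM x => min_le_min_left _ (by exact_mod_cast hNM)
  have hlim : ∀ {q : ℝ → ℝ≥0∞}, Measurable q →
      Filter.Tendsto (fun N : ℕ => ∫⁻ x, min (q x) N) Filter.atTop (nhds (∫⁻ x, q x)) := by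
    intro q hq
    have := lintegral_tendsto_of_tendsto_of_monotone (μ := volume)
      (f := fun (N : ℕ) x => min (q x) (N : ℝ≥0∞)) (F := q)
      (fun N => (hq.min measurable_const).aemeasurable)
      (.of_forall fun x N M hNM => hmono q hNM x)
      (.of_forall fun x => by
        have := tendsto_atTop_iSup (f := fun N : ℕ => min (q x) (N : ℝ≥0∞))
          (fun N M hNM => hmono q hNM x)
        rwa [ENNReal.iSup_min_natCast] at this)
    exact this
  have hbd : ∀ N : ℕ, (∫⁻ x, min (u x) N) ^ t * (∫⁻ x, min (v x) N) ^ s ≤ ∫⁻ x, h x := fun N =>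
    lintegral_prekopaLeindler_of_bounded ht hs hts (hu.min measurable_const)
      (hv.min measurable_const) hh (ENNReal.natCast_ne_top N) (fun _ => min_le_right _ _)
      (fun _ => min_le_right _ _) fun x y => le_trans (by gcongr <;> exact min_le_left _ _) (huv x y)
  rcases eq_or_ne (∫⁻ x, u x) 0 with hu0 | hu0
  · simp [hu0, ht]
  rcases eq_or_ne (∫⁻ x, v x) 0 with hv0 | hv0
  · simp [hv0, hs]
  have hu0' : (∫⁻ x, u x) ^ t ≠ 0 := by simp [hu0, ht, ht.not_gt]
  have hv0' : (∫⁻ x, v x) ^ s ≠ 0 := by simp [hv0, hs, hs.not_gt]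
  exact le_of_tendsto' (ENNReal.Tendsto.mul ((hlim hu).ennrpow_const t) (.inl hu0')
    ((hlim hv).ennrpow_const s) (.inl hv0')) hbd

theorem PrekopaLeindler.prod {E F : Type*} [AddCommGroup E] [Module ℝ E] [MeasureSpace E]
    [AddCommGroup F] [Module ℝ F] [MeasureSpace F] [SFinite (volume : Measure F)]
    (hE : PrekopaLeindler E) (hF : PrekopaLeindler F) : PrekopaLeindler (E × F) := by
  intro t s ht hs hts u v h hu hv hh huv
  rw [Measure.volume_eq_prod, lintegral_prod _ hu.aemeasurable, lintegral_prod _ hv.aemeasurable,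
    lintegral_prod _ hh.aemeasurable]
  exact hE ht hs hts hu.lintegral_prod_right' hv.lintegral_prod_right' hh.lintegral_prod_right'
    fun x x' => hF ht hs hts (hu.comp measurable_prodMk_left)
      (hv.comp measurable_prodMk_left) (hh.comp measurable_prodMk_left)
      fun y y' => huv (x, y) (x', y')

theorem PrekopaLeindler.of_equiv {E F : Type*} [AddCommGroup E] [Module ℝ E] [MeasureSpace E]
    [AddCommGroup F] [Module ℝ F] [MeasureSpace F] (e : F ≃ᵐ E)
    (he : MeasurePreserving e) (hlin : ∀ (t s : ℝ) x y, e (t • x + s • y) = t • e x + s • e y)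
    (hF : PrekopaLeindler F) : PrekopaLeindler E := by
  intro t s ht hs hts u v h hu hv hh huv
  rw [← he.lintegral_comp hu, ← he.lintegral_comp hv, ← he.lintegral_comp hh]
  exact hF ht hs hts (hu.comp e.measurable) (hv.comp e.measurable) (hh.comp e.measurable)
    fun x y => by simpa only [Function.comp, hlin] using huv (e x) (e y)

theorem prekopaLeindler_pi : ∀ d : ℕ, PrekopaLeindler (Fin d → ℝ)
  | 0 => by
    intro t s ht hs hts u v h hu hv hh huv
    have : (volume : Measure (Fin 0 → ℝ)) = Measure.dirac 0 := Measure.volume_pi_eq_dirac 0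
    simp only [this, lintegral_dirac]
    simpa using huv 0 0
  | d + 1 => by
    have e := volume_preserving_piFinSuccAbove (fun _ : Fin (d + 1) => ℝ) 0
    refine .of_equiv (MeasurableEquiv.piFinSuccAbove (fun _ : Fin (d + 1) => ℝ) 0).symm e.symm ?_
      (prekopaLeindler_real.prod (prekopaLeindler_pi d))
    intro t s x y
    ext i
    refine Fin.cases ?_ (fun j => ?_) i <;> simp [MeasurableEquiv.piFinSuccAbove]

theorem prekopaLeindler_euclideanSpace (d : ℕ) : PrekopaLeindler (EuclideanSpace ℝ (Fin d)) :=
  .of_equiv (MeasurableEquiv.toLp 2 (Fin d → ℝ)) (PiLp.volume_preserving_toLp (Fin d))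
    (fun _ _ _ _ => rfl) (prekopaLeindler_pi d)

section LogConcave

variable {m : ℝ} {V : EuclideanSpace ℝ (Fin d) → ℝ}

theorem integrable_exp_neg_mul_sq_norm {b : ℝ} (hb : 0 < b) :
    Integrable fun w : EuclideanSpace ℝ (Fin d) => Real.exp (-b * ‖w‖ ^ 2) := by
  have h := (GaussianFourier.integrable_cexp_neg_mul_sq_norm_add
    (V := EuclideanSpace ℝ (Fin d)) (b := b) (by simpa using hb) 0 0).norm
  refine h.congr (.of_forall fun w => ?_)
  simp only [Complex.norm_exp]
  norm_cast
  simp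

/-- A strongly convex potential gives all exponential moments of the norm. -/
theorem integrable_exp_mul_norm_sub (hm : 0 < m) (hV : Continuous V)
    (hsc : ConvexOn ℝ Set.univ fun w => V w - m / 2 * ‖w‖ ^ 2) (K : ℝ) :
    Integrable fun w => Real.exp (K * ‖w‖ - V w) := by
  have hcont : Continuous fun w => V w - m / 2 * ‖w‖ ^ 2 := by fun_prop
  obtain ⟨l, c, hlc, -⟩ := hsc.exists_affine_le_of_lt (𝕜 := ℝ) (Set.mem_univ 0) (sub_one_lt _)
    isClosed_univ (hcont.lowerSemicontinuous.lowerSemicontinuousOn _)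
  have hl : ∀ w, l w + c ≤ V w - m / 2 * ‖w‖ ^ 2 := fun w => hlc ⟨w, Set.mem_univ w⟩
  have hint := (integrable_exp_neg_mul_sq_norm (d := d) (b := m / 4) (by positivity)).const_mul
    (Real.exp ((K + ‖l‖) ^ 2 / m - c))
  refine hint.mono' (by fun_prop) (.of_forall fun w => ?_)
  rw [Real.norm_of_nonneg (Real.exp_pos _).le, ← Real.exp_add, Real.exp_le_exp]
  have h1 := hl w
  have h2 : -(‖l‖ * ‖w‖) ≤ l w := neg_le_of_abs_le (l.le_opNorm w)
  have h3 : (K + ‖l‖) * ‖w‖ ≤ (K + ‖l‖) ^ 2 / m + m / 4 * ‖w‖ ^ 2 := by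
    have : (K + ‖l‖) ^ 2 / m + m / 4 * ‖w‖ ^ 2 - (K + ‖l‖) * ‖w‖
        = (K + ‖l‖ - m / 2 * ‖w‖) ^ 2 / m := by field_simp; ring
    have : 0 ≤ (K + ‖l‖ - m / 2 * ‖w‖) ^ 2 / m := by positivity
    linarith
  linarith

theorem strongConvex_convexComb_le
    (hsc : ConvexOn ℝ Set.univ fun w => V w - m / 2 * ‖w‖ ^ 2) {t s : ℝ} (ht : 0 < t)
    (hs : 0 < s) (hts : t + s = 1) (x y : EuclideanSpace ℝ (Fin d)) :
    V (t • x + s • y) ≤ t * V x + s * V y - t * s * (m / 2 * ‖x - y‖ ^ 2) := by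
  have h := hsc.2 (Set.mem_univ x) (Set.mem_univ y) ht.le hs.le hts
  have hnorm : ‖t • x + s • y‖ ^ 2 = t * ‖x‖ ^ 2 + s * ‖y‖ ^ 2 - t * s * ‖x - y‖ ^ 2 := by
    obtain rfl : s = 1 - t := by linarith
    rw [norm_add_sq_real, norm_sub_sq_real, norm_smul, norm_smul, inner_smul_left,
      inner_smul_right, mul_pow, mul_pow]
    simp only [Real.norm_eq_abs, sq_abs, conj_trivial]
    ring
  simp only [smul_eq_mul, hnorm] at h
  linarith

theorem Real.exp_le_one_add_add_sq_mul (y : ℝ) :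
    Real.exp y ≤ 1 + y + y ^ 2 * Real.exp |y| := by
  have h1 : Real.exp y * (1 - y) ≤ 1 := by
    calc Real.exp y * (1 - y) ≤ Real.exp y * Real.exp (-y) := by
          gcongr; linarith [Real.add_one_le_exp (-y)]
      _ = 1 := by rw [← Real.exp_add]; simp
  rcases le_total 0 y with hy | hy
  · rw [abs_of_nonneg hy]
    nlinarith
  · rw [abs_of_nonpos hy]
    have h2 := Real.add_one_le_exp y
    have h3 : 1 ≤ Real.exp (-y) := Real.one_le_exp (by linarith)
    nlinarith [mul_nonneg (sq_nonneg y) (sub_nonneg.2 h3)]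

theorem Real.exp_mul_le_one_add_add {t : ℝ} (ht : 0 ≤ t) (ht1 : t ≤ 1) (x : ℝ) :
    Real.exp (t * x) ≤ 1 + t * x + t ^ 2 * (2 * Real.exp (2 * |x|)) := by
  refine (Real.exp_le_one_add_add_sq_mul (t * x)).trans ?_
  have h1 : |t * x| ≤ |x| := by
    rw [abs_mul, abs_of_nonneg ht]
    exact mul_le_of_le_one_left (abs_nonneg x) ht1
  have h2 : x ^ 2 ≤ 2 * Real.exp |x| := by
    have := Real.quadratic_le_exp_of_nonneg (abs_nonneg x)
    rw [sq_abs] at this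
    linarith [abs_nonneg x]
  have h3 : (t * x) ^ 2 * Real.exp |t * x| ≤ t ^ 2 * (2 * Real.exp (2 * |x|)) := by
    calc (t * x) ^ 2 * Real.exp |t * x| ≤ (t * x) ^ 2 * Real.exp |x| := by gcongr
      _ = t ^ 2 * (x ^ 2 * Real.exp |x|) := by ring
      _ ≤ t ^ 2 * (2 * Real.exp |x| * Real.exp |x|) := by gcongr
      _ = _ := by rw [two_mul |x|, Real.exp_add]; ring
  linarith

/-- Exponentials of Lipschitz functions are integrable against `exp (-V)`. -/
theorem integrable_exp_sub_of_lipschitz (hm : 0 < m) (hV : Continuous V)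
    (hsc : ConvexOn ℝ Set.univ fun w => V w - m / 2 * ‖w‖ ^ 2)
    {f : EuclideanSpace ℝ (Fin d) → ℝ} (hf : Continuous f) {G : ℝ}
    (hG : ∀ u v, |f u - f v| ≤ G * ‖u - v‖) {K : ℝ} (hK : 0 ≤ K) :
    Integrable fun w => Real.exp (K * |f w| - V w) := by
  refine ((integrable_exp_mul_norm_sub hm hV hsc (K * G)).const_mul
    (Real.exp (K * |f 0|))).mono' (by fun_prop) (.of_forall fun w => ?_)
  rw [Real.norm_of_nonneg (Real.exp_pos _).le, ← Real.exp_add, Real.exp_le_exp]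
  have h1 : |f w| ≤ |f 0| + G * ‖w‖ := by
    have h2 := hG w 0
    rw [sub_zero] at h2
    linarith [abs_sub_abs_le_abs_sub (f w) (f 0)]
  have := mul_le_mul_of_nonneg_left h1 hK
  linarith

theorem integral_exp_rpow_mul_le (hm : 0 < m) (hV : Continuous V)
    (hsc : ConvexOn ℝ Set.univ fun w => V w - m / 2 * ‖w‖ ^ 2)
    {f : EuclideanSpace ℝ (Fin d) → ℝ} (hf : Continuous f) {G : ℝ}
    (hG : ∀ u v, |f u - f v| ≤ G * ‖u - v‖) {t s : ℝ} (ht : 0 < t) (hs : 0 < s)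
    (hts : t + s = 1) :
    (∫ w, Real.exp (f w - V w)) ^ t * (∫ w, Real.exp (-V w)) ^ s ≤
      Real.exp (t * s * (G ^ 2 / (2 * m))) * ∫ w, Real.exp (t * f w - V w) := by
  have hint : ∀ r : ℝ, Integrable fun w => Real.exp (r * f w - V w) := fun r => by
    refine (integrable_exp_sub_of_lipschitz hm hV hsc hf hG (abs_nonneg r)).mono' (by fun_prop)
      (.of_forall fun w => ?_)
    rw [Real.norm_of_nonneg (Real.exp_pos _).le, Real.exp_le_exp, ← abs_mul]
    linarith [le_abs_self (r * f w)]
  have hpl := prekopaLeindler_euclideanSpace d ht hs hts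
    (u := fun w => ENNReal.ofReal (Real.exp (f w - V w)))
    (v := fun w => ENNReal.ofReal (Real.exp (-V w)))
    (h := fun w => ENNReal.ofReal
      (Real.exp (t * s * (G ^ 2 / (2 * m))) * Real.exp (t * f w - V w)))
    (by fun_prop) (by fun_prop) (by fun_prop) (fun x y => by
      rw [ENNReal.ofReal_rpow_of_nonneg (Real.exp_pos _).le ht.le,
        ENNReal.ofReal_rpow_of_nonneg (Real.exp_pos _).le hs.le,
        ← ENNReal.ofReal_mul (by positivity), ← Real.exp_mul, ← Real.exp_mul, ← Real.exp_add,
        ← Real.exp_add]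
      refine ENNReal.ofReal_le_ofReal (Real.exp_le_exp.2 ?_)
      have h1 := strongConvex_convexComb_le hsc ht hs hts x y
      have h2 : f x - f (t • x + s • y) ≤ s * (G * ‖x - y‖) := by
        refine (le_abs_self _).trans ((hG _ _).trans_eq ?_)
        have : x - (t • x + s • y) = s • (x - y) := by
          obtain rfl : t = 1 - s := by linarith
          module
        rw [this, norm_smul, Real.norm_of_nonneg hs.le]
        ring
      have h3 : G * ‖x - y‖ ≤ m / 2 * ‖x - y‖ ^ 2 + G ^ 2 / (2 * m) := by
        have : m / 2 * ‖x - y‖ ^ 2 + G ^ 2 / (2 * m) - G * ‖x - y‖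
            = (G - m * ‖x - y‖) ^ 2 / (2 * m) := by field_simp; ring
        have : 0 ≤ (G - m * ‖x - y‖) ^ 2 / (2 * m) := by positivity
        linarith
      have h4 := mul_le_mul_of_nonneg_left h2 ht.le
      have h5 := mul_le_mul_of_nonneg_left h3 (mul_pos ht hs).le
      linarith)
  have hnn : ∀ g : EuclideanSpace ℝ (Fin d) → ℝ, 0 ≤ᵐ[volume] fun w => Real.exp (g w) :=
    fun g => .of_forall fun w => (Real.exp_pos _).le
  have h1 : Integrable fun w => Real.exp (f w - V w) := by simpa using hint 1
  have h0 : Integrable fun w => Real.exp (-V w) := by simpa using hint 0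
  rw [← ofReal_integral_eq_lintegral_ofReal h1 (hnn _),
    ← ofReal_integral_eq_lintegral_ofReal h0 (hnn _),
    ← ofReal_integral_eq_lintegral_ofReal ((hint t).const_mul _)
      (.of_forall fun w => by positivity), integral_const_mul,
    ENNReal.ofReal_rpow_of_nonneg (integral_nonneg fun w => (Real.exp_pos _).le) ht.le,
    ENNReal.ofReal_rpow_of_nonneg (integral_nonneg fun w => (Real.exp_pos _).le) hs.le,
    ← ENNReal.ofReal_mul (by positivity)] at hpl
  exact (ENNReal.ofReal_le_ofReal_iff
    (mul_nonneg (Real.exp_pos _).le (integral_nonneg fun w => (Real.exp_pos _).le))).1 hpl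

theorem integral_exp_mul_le_one_add_add {Ω : Type*} [MeasurableSpace Ω] {P : Measure Ω}
    [IsProbabilityMeasure P] {f : Ω → ℝ} (hf : Integrable f P) {t : ℝ}
    (hexp : Integrable (fun w => Real.exp (t * f w)) P)
    (habs : Integrable (fun w => Real.exp (2 * |f w|)) P) (ht : 0 ≤ t) (ht1 : t ≤ 1) :
    ∫ w, Real.exp (t * f w) ∂P ≤
      1 + t * ∫ w, f w ∂P + t ^ 2 * (2 * ∫ w, Real.exp (2 * |f w|) ∂P) := by
  have hlin : Integrable (fun w => 1 + t * f w) P := (integrable_const 1).add (hf.const_mul t)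
  have hquad : Integrable (fun w => t ^ 2 * (2 * Real.exp (2 * |f w|))) P :=
    (habs.const_mul 2).const_mul _
  calc ∫ w, Real.exp (t * f w) ∂P
      ≤ ∫ w, (1 + t * f w + t ^ 2 * (2 * Real.exp (2 * |f w|))) ∂P :=
        integral_mono hexp (hlin.add hquad) fun w => Real.exp_mul_le_one_add_add ht ht1 (f w)
    _ = _ := by
        rw [integral_add hlin hquad, integral_add (integrable_const 1) (hf.const_mul t),
          integral_const_mul, integral_const_mul, integral_const_mul]
        simp

theorem le_of_forall_Ioo_le_add_mul {a b c C : ℝ}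
    (h : ∀ t ∈ Set.Ioo (0 : ℝ) 1, a ≤ b + (1 - t) * c + t * C) : a ≤ b + c := by
  have hlim : Filter.Tendsto (fun t : ℝ => b + (1 - t) * c + t * C)
      (nhdsWithin 0 (Set.Ioi 0)) (nhds (b + c)) := by
    have hc : Continuous fun t : ℝ => b + (1 - t) * c + t * C := by fun_prop
    simpa using (hc.tendsto 0).mono_left nhdsWithin_le_nhds
  exact ge_of_tendsto hlim (Filter.eventually_of_mem (Ioo_mem_nhdsGT one_pos) h)

theorem integrable_exp_neg_of_strongConvex
    (hm : 0 < m) (hV : Continuous V)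
    (hsc : ConvexOn ℝ Set.univ fun w => V w - m / 2 * ‖w‖ ^ 2) :
    Integrable fun w => Real.exp (-V w) := by
  simpa using integrable_exp_mul_norm_sub hm hV hsc 0

theorem integrable_exp_mul_abs_tilted
    (hm : 0 < m) (hV : Continuous V)
    (hsc : ConvexOn ℝ Set.univ fun w => V w - m / 2 * ‖w‖ ^ 2)
    {f : EuclideanSpace ℝ (Fin d) → ℝ} (hf : Continuous f) {G : ℝ}
    (hG : ∀ u v, |f u - f v| ≤ G * ‖u - v‖) {K : ℝ} (hK : 0 ≤ K) :
    Integrable (fun w => Real.exp (K * |f w|)) (volume.tilted fun w => -V w) := by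
  rw [integrable_tilted_iff (integrable_exp_neg_of_strongConvex hm hV hsc)]
  refine (integrable_exp_sub_of_lipschitz hm hV hsc hf hG hK).congr (.of_forall fun w => ?_)
  simp only [smul_eq_mul, ← Real.exp_add]
  ring_nf

theorem integrable_exp_mul_tilted
    (hm : 0 < m) (hV : Continuous V)
    (hsc : ConvexOn ℝ Set.univ fun w => V w - m / 2 * ‖w‖ ^ 2)
    {f : EuclideanSpace ℝ (Fin d) → ℝ} (hf : Continuous f) {G : ℝ}
    (hG : ∀ u v, |f u - f v| ≤ G * ‖u - v‖) (r : ℝ) :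
    Integrable (fun w => Real.exp (r * f w)) (volume.tilted fun w => -V w) := by
  refine (integrable_exp_mul_abs_tilted hm hV hsc hf hG (abs_nonneg r)).mono' (by fun_prop)
    (.of_forall fun w => ?_)
  rw [Real.norm_of_nonneg (Real.exp_pos _).le, Real.exp_le_exp, ← abs_mul]
  exact le_abs_self _

theorem integrable_tilted_of_lipschitz
    (hm : 0 < m) (hV : Continuous V)
    (hsc : ConvexOn ℝ Set.univ fun w => V w - m / 2 * ‖w‖ ^ 2)
    {f : EuclideanSpace ℝ (Fin d) → ℝ} (hf : Continuous f) {G : ℝ}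
    (hG : ∀ u v, |f u - f v| ≤ G * ‖u - v‖) :
    Integrable f (volume.tilted fun w => -V w) := by
  refine (integrable_exp_mul_abs_tilted hm hV hsc hf hG zero_le_one).mono' (by fun_prop)
    (.of_forall fun w => ?_)
  rw [Real.norm_eq_abs, one_mul]
  linarith [Real.add_one_le_exp |f w|]

theorem mul_log_integral_exp_tilted_le
    (hm : 0 < m) (hV : Continuous V)
    (hsc : ConvexOn ℝ Set.univ fun w => V w - m / 2 * ‖w‖ ^ 2)
    {f : EuclideanSpace ℝ (Fin d) → ℝ} (hf : Continuous f) {G : ℝ}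
    (hG : ∀ u v, |f u - f v| ≤ G * ‖u - v‖)
    {t : ℝ} (ht : 0 < t) (ht1 : t < 1) :
    t * Real.log (∫ w, Real.exp (f w) ∂(volume.tilted fun w => -V w)) ≤
      t * (1 - t) * (G ^ 2 / (2 * m)) +
        Real.log (∫ w, Real.exp (t * f w) ∂(volume.tilted fun w => -V w)) := by
  have h0 := integrable_exp_neg_of_strongConvex hm hV hsc
  have hZpos : 0 < ∫ w, Real.exp (-V w) := integral_exp_pos h0
  have hM : ∀ r : ℝ, ∫ w, Real.exp (r * f w) ∂(volume.tilted fun w => -V w) =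
      (∫ w, Real.exp (r * f w - V w)) / ∫ w, Real.exp (-V w) := fun r => by
    rw [integral_exp_tilted]
    congr 2
    ext w
    simp only [Pi.add_apply]
    ring_nf
  have := isProbabilityMeasure_tilted h0
  have hMpos : ∀ r : ℝ, 0 < ∫ w, Real.exp (r * f w) ∂(volume.tilted fun w => -V w) :=
    fun r => integral_exp_pos (integrable_exp_mul_tilted hm hV hsc hf hG r)
  have hpt := hMpos t
  have hp1 := hMpos 1
  have hM1 := hM 1
  have hMt := hM t
  have h1 := integral_exp_rpow_mul_le hm hV hsc hf hG ht (sub_pos.2 ht1) (by ring)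
  simp only [one_mul] at hM1 hp1
  rw [eq_div_iff hZpos.ne'] at hM1 hMt
  rw [← hM1, ← hMt] at h1
  generalize (∫ w, Real.exp (f w) ∂(volume.tilted fun w => -V w)) = A at *
  generalize (∫ w, Real.exp (t * f w) ∂(volume.tilted fun w => -V w)) = B at *
  generalize (∫ w, Real.exp (-V w)) = Z at *
  have h2 := Real.log_le_log (by positivity) h1
  rw [Real.log_mul (by positivity) (by positivity), Real.log_rpow (by positivity),
    Real.log_rpow hZpos, Real.log_mul hp1.ne' hZpos.ne',
    Real.log_mul (by positivity) (by positivity), Real.log_exp,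
    Real.log_mul hpt.ne' hZpos.ne'] at h2
  linarith

/-- Sub-Gaussian concentration of Lipschitz functions under a strongly log-concave measure. -/
theorem log_integral_exp_tilted_le
    (hm : 0 < m) (hV : Continuous V)
    (hsc : ConvexOn ℝ Set.univ fun w => V w - m / 2 * ‖w‖ ^ 2)
    {f : EuclideanSpace ℝ (Fin d) → ℝ} (hf : Continuous f) {G : ℝ}
    (hG : ∀ u v, |f u - f v| ≤ G * ‖u - v‖) :
    Real.log (∫ w, Real.exp (f w) ∂(volume.tilted fun w => -V w)) ≤
      ∫ w, f w ∂(volume.tilted fun w => -V w) + G ^ 2 / (2 * m) := by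
  have := isProbabilityMeasure_tilted (integrable_exp_neg_of_strongConvex hm hV hsc)
  refine le_of_forall_Ioo_le_add_mul
    (C := 2 * ∫ w, Real.exp (2 * |f w|) ∂(volume.tilted fun w => -V w)) ?_
  rintro t ⟨ht, ht1⟩
  have hexp := integrable_exp_mul_tilted hm hV hsc hf hG t
  have h1 := mul_log_integral_exp_tilted_le hm hV hsc hf hG ht ht1
  have h2 := Real.log_le_sub_one_of_pos (integral_exp_pos hexp)
  have h3 := integral_exp_mul_le_one_add_add
    (integrable_tilted_of_lipschitz hm hV hsc hf hG) hexp
    (integrable_exp_mul_abs_tilted hm hV hsc hf hG zero_le_two) ht.le ht1.le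
  refine le_of_mul_le_mul_left ?_ ht
  linarith

end LogConcave

theorem withDensity_gibbsDens_eq_tilted {π : EuclideanSpace ℝ (Fin d) → ℝ} {ρ : ℝ}
    {ℓ : Fin n → EuclideanSpace ℝ (Fin d) → ℝ} {V : EuclideanSpace ℝ (Fin d) → ℝ}
    (hV : ∀ w, gibbsUnnorm π ρ ℓ w = Real.exp (-V w))
    (hint : Integrable fun w => Real.exp (-V w)) :
    volume.withDensity (gibbsDens π ρ ℓ) = volume.tilted fun w => -V w := by
  unfold Measure.tilted
  congr 1
  ext w
  simp only [gibbsDens, hV]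
  rw [← ofReal_integral_eq_lintegral_ofReal hint (.of_forall fun w => (Real.exp_pos _).le),
    ENNReal.ofReal_div_of_pos (integral_exp_pos hint)]

theorem klDiv'_tilted_right {Ω : Type*} [MeasurableSpace Ω] {P : Measure Ω}
    [IsProbabilityMeasure P] {f : Ω → ℝ} (hf : Integrable f P)
    (hexp : Integrable (fun w => Real.exp (f w)) P) :
    klDiv' P (P.tilted f) = ((Real.log (∫ w, Real.exp (f w) ∂P) - ∫ w, f w ∂P : ℝ) : EReal) := by
  have hself : Integrable (llr P P) P := (integrable_zero _ _ _).congr (llr_self P).symm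
  rw [klDiv', if_pos ⟨absolutelyContinuous_tilted hexp,
    integrable_llr_tilted_right .rfl hf hself hexp⟩,
    integral_llr_tilted_right .rfl hf hexp hself, integral_congr_ae (llr_self P)]
  simp only [Pi.zero_apply, integral_zero]
  congr 1
  ring

theorem gibbs_posterior_kl_bound
    (m ρ L : ℝ) (hm : 0 < m) (hρ : 0 < ρ) (hL : 0 ≤ L)
    (π : EuclideanSpace ℝ (Fin d) → ℝ) (hπpos : ∀ w, 0 < π w)
    (hπprob : ∫ w, π w = 1)
    (hπdiff : Differentiable ℝ (fun w => -Real.log (π w)))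
    (hπdiff2 : Differentiable ℝ (fderiv ℝ (fun w => -Real.log (π w))))
    (hπsc : ConvexOn ℝ Set.univ (fun w => -Real.log (π w) - m / 2 * ‖w‖ ^ 2))
    (ℓ ℓ' : Fin n → EuclideanSpace ℝ (Fin d) → ℝ)
    (hconv : ∀ i, ConvexOn ℝ Set.univ (ℓ i)) (hconv' : ∀ i, ConvexOn ℝ Set.univ (ℓ' i))
    (hlip : ∀ i u v, |ℓ i u - ℓ i v| ≤ L * ‖u - v‖)
    (hlip' : ∀ i u v, |ℓ' i u - ℓ' i v| ≤ L * ‖u - v‖)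
    (hneighbor : ∃ j, ∀ i, i ≠ j → ℓ i = ℓ' i) :
    klDiv' (volume.withDensity (gibbsDens π ρ ℓ))
        (volume.withDensity (gibbsDens π ρ ℓ')) ≤
      ((2 * ρ ^ 2 * L ^ 2 / m : ℝ) : EReal) := by
  obtain ⟨j, hj⟩ := hneighbor
  have hcont : ∀ {g : EuclideanSpace ℝ (Fin d) → ℝ},
      (∀ u v, |g u - g v| ≤ L * ‖u - v‖) → Continuous g := fun hg =>
    (LipschitzWith.of_dist_le_mul (K := ⟨L, hL⟩) fun u v => by
      rw [Real.dist_eq, dist_eq_norm]; exact hg u v).continuous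
  have potential : ∀ k : Fin n → EuclideanSpace ℝ (Fin d) → ℝ,
      (∀ i, ConvexOn ℝ Set.univ (k i)) → (∀ i u v, |k i u - k i v| ≤ L * ‖u - v‖) →
      Continuous (fun w => -Real.log (π w) + ρ * ∑ i, k i w) ∧
      ConvexOn ℝ Set.univ
        (fun w => (-Real.log (π w) + ρ * ∑ i, k i w) - m / 2 * ‖w‖ ^ 2) ∧
      ∀ w, gibbsUnnorm π ρ k w = Real.exp (-(-Real.log (π w) + ρ * ∑ i, k i w)) := by
    intro k hk hkl
    refine ⟨hπdiff.continuous.add (continuous_const.mul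
      (continuous_finsetSum _ fun i _ => hcont (hkl i))), ?_, fun w => ?_⟩
    · have hsum : ConvexOn ℝ Set.univ (∑ i, k i) :=
        Finset.sum_induction _ (ConvexOn ℝ Set.univ) (fun _ _ ha hb => ha.add hb)
          (convexOn_const 0 convex_univ) fun i _ => hk i
      refine (hπsc.add (hsum.smul hρ.le)).congr fun w _ => ?_
      simp only [Pi.add_apply, Finset.sum_apply, smul_eq_mul]
      ring
    · rw [gibbsUnnorm, neg_add, neg_neg, Real.exp_add, Real.exp_log (hπpos w), mul_comm]
  obtain ⟨hV, hsc, hπV⟩ := potential ℓ hconv hlip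
  obtain ⟨hV', hsc', hπV'⟩ := potential ℓ' hconv' hlip'
  have hint := integrable_exp_neg_of_strongConvex hm hV hsc
  set f : EuclideanSpace ℝ (Fin d) → ℝ := fun w => ρ * (ℓ j w - ℓ' j w) with hf
  have hfc : Continuous f := continuous_const.mul ((hcont (hlip j)).sub (hcont (hlip' j)))
  have hfG : ∀ u v, |f u - f v| ≤ 2 * ρ * L * ‖u - v‖ := fun u v => by
    have h1 : f u - f v = ρ * ((ℓ j u - ℓ j v) - (ℓ' j u - ℓ' j v)) := by simp only [hf]; ring
    rw [h1, abs_mul, abs_of_pos hρ]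
    calc ρ * |(ℓ j u - ℓ j v) - (ℓ' j u - ℓ' j v)|
        ≤ ρ * (L * ‖u - v‖ + L * ‖u - v‖) := by
          gcongr
          exact (abs_sub _ _).trans (add_le_add (hlip j u v) (hlip' j u v))
      _ = _ := by ring
  have hdiff : ∀ w, ∑ i, ℓ i w - ∑ i, ℓ' i w = ℓ j w - ℓ' j w := fun w => by
    rw [← Finset.sum_sub_distrib]
    exact Finset.sum_eq_single j (fun i _ hi => by rw [hj i hi, sub_self]) (by simp)
  have htilt : volume.withDensity (gibbsDens π ρ ℓ') =
      (volume.tilted fun w => -(-Real.log (π w) + ρ * ∑ i, ℓ i w)).tilted f := by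
    rw [withDensity_gibbsDens_eq_tilted hπV' (integrable_exp_neg_of_strongConvex hm hV' hsc'),
      tilted_tilted hint]
    congr 1
    ext w
    simp only [Pi.add_apply, hf, ← hdiff]
    ring
  rw [htilt, withDensity_gibbsDens_eq_tilted hπV hint]
  have := isProbabilityMeasure_tilted hint
  rw [klDiv'_tilted_right (integrable_tilted_of_lipschitz hm hV hsc hfc hfG)
    (by simpa using integrable_exp_mul_tilted hm hV hsc hfc hfG 1), EReal.coe_le_coe_iff]
  have key := log_integral_exp_tilted_le hm hV hsc hfc hfG
  have hconst : (2 * ρ * L) ^ 2 / (2 * m) = 2 * ρ ^ 2 * L ^ 2 / m := by field_simp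
  linarith
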